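/- arXiv:1901.06930 — 5 statements merged into one kernel-verified Lean document; each statement's English description precedes it below -/
import Mathlib

section
/- Let B be a symmetric bilinear form on a finite-dimensional complex vector space V, let z_0, …, z_d be pairwise distinct complex numbers, let v_0, …, v_d ∈ V satisfy B(v_i, v_i) = 0 for all i, and let λ_0, …, λ_d be nonzero complex numbers. Then the polynomial Q = Σ_{i,j=0}^{d} λ_i λ_j B(v_i, v_j) L_i L_j is the zero polynomial if and only if the vector μ = (λ_0/ζ_0, …, λ_d/ζ_d) lies in the kernel of the rescaled skew-symmetric matrix A. -/
/-- The `i`-th Lagrange basis polynomial for the nodes `z 0, …, z (N-1)`: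
`L i (z) = ∏_{j ≠ i} (z - z j) / (z i - z j)`. -/
noncomputable def lagrangeBasis {N : ℕ} (z : Fin N → ℂ) (i : Fin N) : Polynomial ℂ :=
  ∏ j ∈ Finset.univ.erase i,
    Polynomial.C ((z i - z j)⁻¹) * (Polynomial.X - Polynomial.C (z j))

/-- `ζ i = ∏_{k ≠ i} (z i - z k)`. -/
noncomputable def nodeProd {N : ℕ} (z : Fin N → ℂ) (i : Fin N) : ℂ :=
  ∏ k ∈ Finset.univ.erase i, (z i - z k)

/-- The rescaled skew-symmetric matrix `A` with `A i i = 0` and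
`A i j = B (v i) (v j) / (z j - z i)` for `i ≠ j`. -/
noncomputable def rescaledMatrix {N : ℕ} {V : Type*} [AddCommGroup V] [Module ℂ V]
    (B : LinearMap.BilinForm ℂ V) (z : Fin N → ℂ) (v : Fin N → V) :
    Matrix (Fin N) (Fin N) ℂ :=
  Matrix.of fun i j => if i = j then 0 else B (v i) (v j) / (z j - z i)

open Polynomial in
/-- A polynomial of degree less than `2 * N` with a double zero at each of `N` distinct nodes
vanishes. -/
theorem Polynomial.eq_zero_of_double_zeros {K : Type*} [Field K] {N : ℕ} {z : Fin N → K}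
    (hz : Function.Injective z) {p : K[X]} (hdeg : p.degree < (2 * N : ℕ)) (h : ∀ i, p.eval (z i) = 0)
    (h' : ∀ i, (derivative p).eval (z i) = 0) : p = 0 := by
  by_contra hp
  have hdvd : ∏ i, (X - C (z i)) ^ 2 ∣ p := by
    refine Finset.prod_dvd_of_coprime (fun i _ j _ hij => ?_) fun i _ => ?_
    · exact (pairwise_coprime_X_sub_C hz hij).pow
    · exact (le_rootMultiplicity_iff hp).1
        ((one_lt_rootMultiplicity_iff_isRoot hp).2 ⟨h i, h' i⟩)
  have hle := degree_le_of_dvd hdvd hp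
  rw [degree_prod] at hle
  simp only [degree_pow, degree_X_sub_C, Finset.sum_const, Finset.card_univ, Fintype.card_fin]
    at hle
  refine absurd (hle.trans_lt hdeg) (not_lt.2 (le_of_eq ?_))
  simp [mul_comm]

section LagrangeBasis

open Polynomial

variable {N : ℕ} {z : Fin N → ℂ}

theorem lagrangeBasis_eq_basis (i : Fin N) :
    lagrangeBasis z i = Lagrange.basis Finset.univ z i := rfl

theorem nodeProd_ne_zero (hz : Function.Injective z) (i : Fin N) : nodeProd z i ≠ 0 :=
  Finset.prod_ne_zero_iff.2 fun _ hk =>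
    sub_ne_zero.2 fun h => Finset.ne_of_mem_erase hk (hz h).symm

theorem eval_lagrangeBasis (hz : Function.Injective z) (i j : Fin N) :
    (lagrangeBasis z i).eval (z j) = if i = j then 1 else 0 := by
  rw [lagrangeBasis_eq_basis]
  split_ifs with h
  · subst h
    exact Lagrange.eval_basis_self hz.injOn (Finset.mem_univ _)
  · exact Lagrange.eval_basis_of_ne h (Finset.mem_univ _)

theorem natDegree_lagrangeBasis (hz : Function.Injective z) (i : Fin N) :
    (lagrangeBasis z i).natDegree = N - 1 := by
  rw [lagrangeBasis_eq_basis, Lagrange.natDegree_basis hz.injOn (Finset.mem_univ _)]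
  simp

theorem X_sub_C_mul_lagrangeBasis (i : Fin N) :
    (X - C (z i)) * lagrangeBasis z i =
      C (nodeProd z i)⁻¹ * Lagrange.nodal Finset.univ z := by
  rw [Lagrange.nodal_eq_mul_nodal_erase (Finset.mem_univ i), lagrangeBasis,
    Finset.prod_mul_distrib, nodeProd, ← Finset.prod_inv_distrib, map_prod, Lagrange.nodal]
  ring

theorem eval_derivative_lagrangeBasis (hz : Function.Injective z) {i j : Fin N} (hij : i ≠ j) :
    (derivative (lagrangeBasis z i)).eval (z j) =
      nodeProd z j / (nodeProd z i * (z j - z i)) := by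
  have h := congrArg (fun p => (derivative p).eval (z j)) (X_sub_C_mul_lagrangeBasis (z := z) i)
  simp only [derivative_mul, derivative_sub, derivative_X, derivative_C, eval_add, eval_mul,
    eval_sub, eval_X, eval_C, eval_lagrangeBasis hz, if_neg hij, eval_one, eval_zero,
    Lagrange.eval_nodal_derivative_eval_node_eq (Finset.mem_univ j), Lagrange.eval_nodal] at h
  have h1 : z j - z i ≠ 0 := sub_ne_zero.2 fun e => hij (hz e).symm
  have h2 := nodeProd_ne_zero hz i
  change _ = _ + _ * nodeProd z j at h
  field_simp
  field_simp at h
  linear_combination h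

/-- A double sum `∑ i j, c i j * L i * L j` has degree less than `2 * N`. -/
theorem degree_sum_lagrangeBasis_mul_lt (hz : Function.Injective z) (c : Fin N → Fin N → ℂ) :
    (∑ i, ∑ j, C (c i j) * (lagrangeBasis z i * lagrangeBasis z j)).degree < (2 * N : ℕ) := by
  rcases N.eq_zero_or_pos with rfl | hN
  · simp
  refine degree_le_natDegree.trans_lt (Nat.cast_lt.2 (lt_of_le_of_lt (b := 2 * (N - 1)) ?_ ?_))
  · refine natDegree_sum_le_of_forall_le _ _ fun i _ =>
      natDegree_sum_le_of_forall_le _ _ fun j _ =>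
        (natDegree_C_mul_le _ _).trans (natDegree_mul_le.trans ?_)
    rw [natDegree_lagrangeBasis hz, natDegree_lagrangeBasis hz, two_mul]
  · omega

theorem eval_sum_lagrangeBasis_mul (hz : Function.Injective z) (c : Fin N → Fin N → ℂ)
    (m : Fin N) :
    (∑ i, ∑ j, C (c i j) * (lagrangeBasis z i * lagrangeBasis z j)).eval (z m) = c m m := by
  simp [eval_finsetSum, eval_lagrangeBasis hz]

theorem eval_derivative_sum_lagrangeBasis_mul (hz : Function.Injective z)
    {c : Fin N → Fin N → ℂ} (hc : ∀ i j, c i j = c j i) (m : Fin N) :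
    (derivative (∑ i, ∑ j, C (c i j) * (lagrangeBasis z i * lagrangeBasis z j))).eval (z m) =
      2 * ∑ j, c m j * (derivative (lagrangeBasis z j)).eval (z m) := by
  simp only [derivative_sum, derivative_mul, derivative_C, zero_mul, zero_add, eval_finsetSum,
    eval_mul, eval_add, eval_C, eval_lagrangeBasis hz, mul_add, Finset.sum_add_distrib,
    ite_mul, mul_ite, one_mul, mul_one, mul_zero, Finset.sum_ite_eq', Finset.sum_ite_irrel,
    Finset.sum_const_zero, Finset.mem_univ, if_true, two_mul]
  simp only [hc _ m]

end LagrangeBasis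

/-- For a symmetric bilinear form `B` on a finite-dimensional complex vector space, pairwise
distinct nodes `z i`, isotropic vectors `v i`, and nonzero scalars `λ i`, the polynomial
`Q = ∑ i j, λ i * λ j * B (v i) (v j) * L i * L j` is the zero polynomial if and only if the
vector `μ = (λ_0/ζ_0, …, λ_d/ζ_d)` lies in the kernel of the rescaled skew-symmetric
matrix `A`. -/
theorem quadric_polynomial_eq_zero_iff_kernel
    (d : ℕ) {V : Type*} [AddCommGroup V] [Module ℂ V] [FiniteDimensional ℂ V]
    (B : LinearMap.BilinForm ℂ V) (hB : ∀ x y, B x y = B y x)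
    (z : Fin (d + 1) → ℂ) (hz : Function.Injective z)
    (v : Fin (d + 1) → V) (hiso : ∀ i, B (v i) (v i) = 0)
    (lam : Fin (d + 1) → ℂ) (hlam : ∀ i, lam i ≠ 0) :
    (∑ i : Fin (d + 1), ∑ j : Fin (d + 1),
        Polynomial.C (lam i * lam j * B (v i) (v j)) *
          (lagrangeBasis z i * lagrangeBasis z j)) = 0
      ↔ (rescaledMatrix B z v).mulVec (fun i => lam i / nodeProd z i) = 0 := by
  set c : Fin (d + 1) → Fin (d + 1) → ℂ := fun i j => lam i * lam j * B (v i) (v j) with hc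
  have hsymm : ∀ i j, c i j = c j i := fun i j => by
    simp only [hc, hB (v i) (v j), mul_comm (lam i)]
  have hderiv : ∀ m, (Polynomial.derivative (∑ i, ∑ j, Polynomial.C (c i j) *
      (lagrangeBasis z i * lagrangeBasis z j))).eval (z m) = -2 * (lam m * nodeProd z m) *
        (rescaledMatrix B z v).mulVec (fun i => lam i / nodeProd z i) m := fun m => by
    rw [eval_derivative_sum_lagrangeBasis_mul hz hsymm, Matrix.mulVec, dotProduct,
      Finset.mul_sum, Finset.mul_sum]
    refine Finset.sum_congr rfl fun j _ => ?_
    rcases eq_or_ne j m with rfl | hjm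
    · simp [hc, hiso, rescaledMatrix]
    · rw [eval_derivative_lagrangeBasis hz hjm]
      have h1 : z m - z j ≠ 0 := sub_ne_zero.2 fun e => hjm (hz e).symm
      have h2 := nodeProd_ne_zero hz j
      simp only [hc, rescaledMatrix, Matrix.of_apply, if_neg hjm.symm]
      rw [← neg_sub (z m)]
      field_simp
  constructor
  · intro hQ
    funext m
    have h := hderiv m
    rw [hQ, Polynomial.derivative_zero, Polynomial.eval_zero] at h
    exact (mul_eq_zero.1 h.symm).resolve_left
      (mul_ne_zero (neg_ne_zero.2 two_ne_zero) (mul_ne_zero (hlam m) (nodeProd_ne_zero hz m)))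
  · intro hA
    refine Polynomial.eq_zero_of_double_zeros hz (degree_sum_lagrangeBasis_mul_lt hz c)
      (fun m => ?_) fun m => ?_
    · rw [eval_sum_lagrangeBasis_mul hz]
      simp [hiso]
    · rw [hderiv, hA, Pi.zero_apply, mul_zero]
end

section
/- Let k ≥ 1 and let z_0, …, z_{2k−1} be pairwise distinct complex numbers. Let M be the 2k × 2k matrix with entries M_{ij} = 1/(z_j − z_i) whenever i + j is odd and M_{ij} = 0 whenever i + j is even (indices i, j ∈ [0, 2k−1]). Then det M = ( ∏_{0 ≤ i < j ≤ 2k−1, i+j even} (z_i − z_j) / ∏_{0 ≤ i < j ≤ 2k−1, i+j odd} (z_i − z_j) )². In particular, M is invertible. -/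
/-- The **Cauchy determinant**. -/
theorem Matrix.det_cauchy {K : Type*} [Field K] {n : ℕ} (x y : Fin n → K)
    (hxy : ∀ i j, x i ≠ y j) :
    (Matrix.of fun i j => (x i - y j)⁻¹).det =
      (∏ i, ∏ j, if i < j then (x j - x i) * (y i - y j) else 1) /
        ∏ i, ∏ j, (x i - y j) := by
  induction n with
  | zero => simp
  | succ n ih =>
    have hne (i j) : x i - y j ≠ 0 := sub_ne_zero.2 (hxy i j)
    let c : Fin (n + 1) → K := fun i => if i = 0 then 0 else (x 0 - y 0) * (x i - y 0)⁻¹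
    let N : Matrix (Fin (n + 1)) (Fin (n + 1)) K :=
      Matrix.of fun i j => (x i - y j)⁻¹ - c i * (x 0 - y j)⁻¹
    have hN : (Matrix.of fun i j => (x i - y j)⁻¹).det = N.det :=
      Matrix.det_eq_of_forall_row_eq_smul_add_const c 0 (by simp [c])
        fun i j => by simp [N, c]
    have hN_zero (i : Fin n) : N i.succ 0 = 0 := by
      have := hne 0 0
      simp [N, c]
      field_simp
      simp
    have hN_succ : N.submatrix Fin.succ Fin.succ = Matrix.of fun i j =>
        ((x i.succ - x 0) / (x i.succ - y 0)) *
          (((y 0 - y j.succ) / (x 0 - y j.succ)) * (x i.succ - y j.succ)⁻¹) := by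
      ext i j
      have h₁ := hne i.succ j.succ
      have h₂ := hne i.succ 0
      have h₃ := hne 0 j.succ
      simp [N, c]
      field_simp
      ring
    have hdet := (Matrix.det_mul_column (fun i : Fin n => (x i.succ - x 0) / (x i.succ - y 0))
      (Matrix.of fun i j => ((y 0 - y j.succ) / (x 0 - y j.succ)) *
        (x i.succ - y j.succ)⁻¹)).trans (congrArg _ (Matrix.det_mul_row
          (fun j : Fin n => (y 0 - y j.succ) / (x 0 - y j.succ))
          (Matrix.of fun i j => (x i.succ - y j.succ)⁻¹)))
    simp only [Matrix.of_apply] at hdet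
    rw [hN, Matrix.det_succ_column_zero, Fin.sum_univ_succ]
    simp only [hN_zero, Fin.val_zero, Fin.succAbove_zero, hN_succ, hdet,
      ih (fun i => x i.succ) (fun i => y i.succ) fun i j => hxy _ _]
    simp [Fin.prod_univ_succ, N, c, Finset.prod_mul_distrib, Finset.prod_div_distrib]
    field_simp

theorem Matrix.det_fromBlocks_zero_neg_transpose {R n : Type*} [CommRing R] [Fintype n]
    [DecidableEq n] (B : Matrix n n R) :
    (Matrix.fromBlocks 0 B (-B.transpose) 0).det = B.det ^ 2 := by
  have h : Matrix.fromBlocks 0 B (-B.transpose) 0 = Matrix.fromBlocks B 0 0 B.transpose *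
      (Matrix.fromBlocks 1 1 0 1 * Matrix.fromBlocks 1 0 (-1) 1 *
        Matrix.fromBlocks 1 1 0 1) := by
    simp [Matrix.fromBlocks_multiply]
  rw [h]
  simp [Matrix.det_mul, sq]

/-- The equivalence listing the even indices, then the odd ones. -/
noncomputable def finSumFinEquivEvenOdd (k : ℕ) : Fin k ⊕ Fin k ≃ Fin (2 * k) :=
  Equiv.ofBijective
    (Sum.elim (fun a => ⟨2 * a, by lia⟩) (fun b => ⟨2 * b + 1, by lia⟩)) <| by
    rw [Fintype.bijective_iff_injective_and_card]
    refine ⟨?_, by simp [two_mul]⟩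
    rintro (a | a) (b | b) h <;> simp [Fin.ext_iff] at h ⊢ <;> lia

@[simp]
theorem finSumFinEquivEvenOdd_inl_val {k : ℕ} (a : Fin k) :
    (finSumFinEquivEvenOdd k (Sum.inl a) : ℕ) = 2 * a := rfl

@[simp]
theorem finSumFinEquivEvenOdd_inr_val {k : ℕ} (b : Fin k) :
    (finSumFinEquivEvenOdd k (Sum.inr b) : ℕ) = 2 * b + 1 := rfl

theorem prod_filter_lt_even_sq {R : Type*} [CommRing R] {k : ℕ} (z : Fin (2 * k) → R) :
    (∏ p ∈ Finset.univ.filter (fun p : Fin (2 * k) × Fin (2 * k) =>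
      p.1 < p.2 ∧ Even ((p.1 : ℕ) + (p.2 : ℕ))), (z p.1 - z p.2)) ^ 2 =
      (∏ a, ∏ b, if a < b then
        (z (finSumFinEquivEvenOdd k (.inl b)) - z (finSumFinEquivEvenOdd k (.inl a))) *
        (z (finSumFinEquivEvenOdd k (.inr a)) - z (finSumFinEquivEvenOdd k (.inr b)))
        else 1) ^ 2 := by
  rw [Finset.prod_filter, Fintype.prod_prod_type]
  simp only [← (finSumFinEquivEvenOdd k).prod_comp, Fintype.prod_sum_type, Fin.lt_def,
    finSumFinEquivEvenOdd_inl_val, finSumFinEquivEvenOdd_inr_val]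
  simp only [← Finset.prod_mul_distrib, ← Finset.prod_pow]
  refine Finset.prod_congr rfl fun a _ => Finset.prod_congr rfl fun b _ => ?_
  have h₁ : ¬ Even (2 * (a : ℕ) + (2 * b + 1)) := by grind
  have h₂ : ¬ Even (2 * (a : ℕ) + 1 + 2 * b) := by grind
  have h₃ : Even (2 * (a : ℕ) + 2 * b) := by grind
  have h₄ : Even (2 * (a : ℕ) + 1 + (2 * b + 1)) := by grind
  simp only [h₁, h₂, h₃, h₄, and_true, and_false, if_false, mul_one, one_mul,
    add_lt_add_iff_right, Nat.mul_lt_mul_left two_pos]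
  split_ifs <;> ring

theorem prod_filter_lt_odd_sq {R : Type*} [CommRing R] {k : ℕ} (z : Fin (2 * k) → R) :
    (∏ p ∈ Finset.univ.filter (fun p : Fin (2 * k) × Fin (2 * k) =>
      p.1 < p.2 ∧ Odd ((p.1 : ℕ) + (p.2 : ℕ))), (z p.1 - z p.2)) ^ 2 =
      (∏ a, ∏ b,
        (z (finSumFinEquivEvenOdd k (.inr a)) - z (finSumFinEquivEvenOdd k (.inl b)))) ^ 2 := by
  rw [Finset.prod_filter, Fintype.prod_prod_type]
  simp only [← (finSumFinEquivEvenOdd k).prod_comp, Fintype.prod_sum_type, Fin.lt_def,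
    finSumFinEquivEvenOdd_inl_val, finSumFinEquivEvenOdd_inr_val]
  have h₁ (a b : ℕ) : Odd (2 * a + (2 * b + 1)) := by grind
  have h₂ (a b : ℕ) : Odd (2 * a + 1 + 2 * b) := by grind
  have h₃ (a b : ℕ) : ¬ Odd (2 * a + 2 * b) := by grind
  have h₄ (a b : ℕ) : ¬ Odd (2 * a + 1 + (2 * b + 1)) := by grind
  simp only [h₁, h₂, h₃, h₄, and_true, and_false, if_false, mul_one, one_mul,
    Finset.prod_const_one]
  rw [Finset.prod_comm]
  simp only [← Finset.prod_mul_distrib, ← Finset.prod_pow]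
  refine Finset.prod_congr rfl fun a _ => Finset.prod_congr rfl fun b _ => ?_
  by_cases h : 2 * (a : ℕ) + 1 < 2 * b
  · rw [if_neg (by lia), if_pos h, one_mul]
  · rw [if_pos (by lia), if_neg h]
    ring

/-- For `k ≥ 1` and pairwise distinct complex numbers `z 0, …, z (2k-1)`, the `2k × 2k`
matrix `M` with `M i j = 1/(z j - z i)` when `i + j` is odd and `M i j = 0` when `i + j`
is even has determinant
`( ∏_{i<j, i+j even} (z i - z j) / ∏_{i<j, i+j odd} (z i - z j) )²`; in particular `M`
is invertible. -/
theorem det_alternating_cauchy_matrix_even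
    (k : ℕ) (hk : 1 ≤ k) (z : Fin (2 * k) → ℂ) (hz : Function.Injective z)
    (M : Matrix (Fin (2 * k)) (Fin (2 * k)) ℂ)
    (hM : ∀ i j, M i j = if Odd ((i : ℕ) + (j : ℕ)) then (z j - z i)⁻¹ else 0) :
    M.det =
      ((∏ p ∈ Finset.univ.filter (fun p : Fin (2 * k) × Fin (2 * k) =>
            p.1 < p.2 ∧ Even ((p.1 : ℕ) + (p.2 : ℕ))), (z p.1 - z p.2)) /
        (∏ p ∈ Finset.univ.filter (fun p : Fin (2 * k) × Fin (2 * k) =>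
            p.1 < p.2 ∧ Odd ((p.1 : ℕ) + (p.2 : ℕ))), (z p.1 - z p.2))) ^ 2
      ∧ IsUnit M := by
  have hsub (i j : Fin (2 * k)) (h : (i : ℕ) ≠ j) : z i - z j ≠ 0 :=
    sub_ne_zero.2 fun h' => h (congrArg _ (hz h'))
  rw [and_iff_left_of_imp]
  · let e := finSumFinEquivEvenOdd k
    let B : Matrix (Fin k) (Fin k) ℂ :=
      Matrix.of fun a b => (z (e (.inr a)) - z (e (.inl b)))⁻¹
    have hB : M.submatrix e e = Matrix.fromBlocks 0 B.transpose (-B.transpose.transpose) 0 := by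
      ext (a | a) (b | b)
      · simp [hM, e, ← mul_add]
      · simp [hM, e, B, ← add_assoc, ← mul_add]
      · have : Odd (2 * (a : ℕ) + 1 + 2 * b) := by grind
        simp [hM, e, B, this, ← inv_neg]
      · have : ¬ Odd (2 * (a : ℕ) + 1 + (2 * b + 1)) := by grind
        simp [hM, e, this]
    rw [← Matrix.det_submatrix_equiv_self e M, hB, Matrix.det_fromBlocks_zero_neg_transpose,
      Matrix.det_transpose, Matrix.det_cauchy _ _ fun a b => sub_ne_zero.1 <|
        hsub _ _ (by simp [e]; lia),
      div_pow, div_pow, prod_filter_lt_even_sq, prod_filter_lt_odd_sq]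
    congr 2
    refine Finset.prod_congr rfl fun a _ => Finset.prod_congr rfl fun b _ => ?_
    split_ifs <;> ring
  · intro hdet
    rw [Matrix.isUnit_iff_isUnit_det, isUnit_iff_ne_zero, hdet]
    refine pow_ne_zero 2 (div_ne_zero ?_ ?_) <;>
      exact Finset.prod_ne_zero_iff.2 fun p hp => hsub _ _ <| by
        have := (Finset.mem_filter.1 hp).2.1
        lia
end

section
/- Let k ≥ 1 and let z_0, …, z_{2k} be pairwise distinct complex numbers. Let M be the (2k+1) × (2k+1) matrix with entries M_{ij} = 1/(z_j − z_i) whenever i + j is odd and M_{ij} = 0 whenever i + j is even (indices i, j ∈ [0, 2k]). Then the rank of M equals 2k. -/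
open Polynomial in
/-- A square Cauchy matrix with pairwise distinct nodes is nonsingular. -/
theorem Matrix.det_cauchy_ne_zero {ι K : Type*} [Fintype ι] [DecidableEq ι] [Field K]
    {x y : ι → K} (hx : Function.Injective x) (hy : Function.Injective y)
    (hxy : ∀ i j, x i ≠ y j) :
    (Matrix.of fun i j => (y j - x i)⁻¹).det ≠ 0 := by
  intro hdet
  obtain ⟨v, hv, hCv⟩ := Matrix.exists_mulVec_eq_zero_iff.mpr hdet
  set P : K[X] := ∑ j, C (v j) * ∏ l ∈ Finset.univ.erase j, (C (y l) - X) with hP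
  have hdeg : P.degree < (Finset.univ : Finset ι).card := by
    refine (degree_sum_le _ _).trans_lt
      ((Finset.sup_lt_iff (WithBot.bot_lt_coe _)).mpr fun j hj => ?_)
    calc (C (v j) * ∏ l ∈ Finset.univ.erase j, (C (y l) - X)).degree
        ≤ (∏ l ∈ Finset.univ.erase j, (C (y l) - X)).degree := by
          rw [C_mul']
          exact degree_smul_le _ _
      _ = ((Finset.univ.erase j).card : WithBot ℕ) := by
          have h (a : K) : (C a - X).degree = 1 := by
            rw [← neg_sub, degree_neg, degree_X_sub_C]
          simp [degree_prod, h]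
      _ < _ := by exact_mod_cast Finset.card_erase_lt_of_mem hj
  have hP0 : P = 0 := by
    refine eq_zero_of_degree_lt_of_eval_index_eq_zero _ hx.injOn hdeg fun i _ => ?_
    have hi := congrFun hCv i
    simp only [Matrix.mulVec, dotProduct, Matrix.of_apply, Pi.zero_apply] at hi
    calc P.eval (x i) = (∏ l, (y l - x i)) * ∑ j, (y j - x i)⁻¹ * v j := by
          simp only [hP, eval_finsetSum, eval_mul, eval_C, eval_prod, eval_sub, eval_X,
            Finset.mul_sum]
          refine Finset.sum_congr rfl fun j hj => ?_
          rw [← Finset.mul_prod_erase _ _ hj]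
          field_simp [sub_ne_zero.mpr (hxy i j).symm]
      _ = 0 := by rw [hi, mul_zero]
  refine hv (funext fun j => ?_)
  have hj : P.eval (y j) = v j * ∏ l ∈ Finset.univ.erase j, (y l - y j) := by
    simp only [hP, eval_finsetSum, eval_mul, eval_C, eval_prod, eval_sub, eval_X]
    refine Finset.sum_eq_single j (fun i _ hij => ?_) (by simp)
    rw [Finset.prod_eq_zero (Finset.mem_erase.mpr ⟨hij.symm, Finset.mem_univ j⟩) (sub_self _),
      mul_zero]
  rw [hP0, eval_zero, eq_comm, mul_eq_zero] at hj
  refine hj.resolve_right (Finset.prod_ne_zero_iff.mpr fun l hl => ?_)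
  exact sub_ne_zero.mpr (hy.ne (Finset.ne_of_mem_erase hl))

/-- A skew-symmetric matrix of odd size is singular. -/
theorem Matrix.det_eq_zero_of_transpose_eq_neg {ι K : Type*} [Fintype ι] [DecidableEq ι] [Field K]
    [NeZero (2 : K)] {A : Matrix ι ι K} (hA : A.transpose = -A) (hι : Odd (Fintype.card ι)) :
    A.det = 0 := by
  have h := congrArg Matrix.det hA
  rw [Matrix.det_transpose, Matrix.det_neg, hι.neg_one_pow, neg_one_mul] at h
  have h2 : 2 * A.det = 0 := by linear_combination h
  exact (mul_eq_zero.mp h2).resolve_left two_ne_zero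

/-- A singular square matrix over a field does not have full rank. -/
theorem Matrix.rank_lt_card_of_det_eq_zero {ι K : Type*} [Fintype ι] [DecidableEq ι] [Field K]
    {A : Matrix ι ι K} (hA : A.det = 0) : A.rank < Fintype.card ι := by
  obtain ⟨v, hv, hAv⟩ := Matrix.exists_mulVec_eq_zero_iff.mpr hA
  have hker : 0 < Module.finrank K (LinearMap.ker A.mulVecLin) :=
    Module.finrank_pos_iff_exists_ne_zero.mpr ⟨⟨v, hAv⟩, fun h => hv (congrArg Subtype.val h)⟩
  have h := LinearMap.finrank_range_add_finrank_ker A.mulVecLin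
  rw [Module.finrank_fintype_fun_eq_card] at h
  unfold Matrix.rank
  omega


/-- For `k ≥ 1` and pairwise distinct complex numbers `z 0, …, z (2k)`, the
`(2k+1) × (2k+1)` matrix `M` with `M i j = 1/(z j - z i)` when `i + j` is odd and
`M i j = 0` when `i + j` is even has rank exactly `2k`. -/
theorem rank_alternating_cauchy_matrix_odd
    (k : ℕ) (hk : 1 ≤ k) (z : Fin (2 * k + 1) → ℂ) (hz : Function.Injective z)
    (M : Matrix (Fin (2 * k + 1)) (Fin (2 * k + 1)) ℂ)
    (hM : ∀ i j, M i j = if Odd ((i : ℕ) + (j : ℕ)) then (z j - z i)⁻¹ else 0) :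
    M.rank = 2 * k := by
  apply le_antisymm
  · have hskew : M.transpose = -M := by
      ext i j
      rw [Matrix.transpose_apply, Matrix.neg_apply, hM, hM, add_comm (j : ℕ)]
      split_ifs
      · rw [← inv_neg, neg_sub]
      · rw [neg_zero]
    have h := Matrix.rank_lt_card_of_det_eq_zero
      (Matrix.det_eq_zero_of_transpose_eq_neg hskew (by simp))
    rw [Fintype.card_fin] at h
    omega
  · let e : Fin k → Fin (2 * k + 1) := fun i => ⟨2 * i, by omega⟩
    let o : Fin k → Fin (2 * k + 1) := fun i => ⟨2 * i + 1, by omega⟩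
    have he : Function.Injective e := fun i j h => by
      simp only [e, Fin.mk.injEq] at h
      omega
    have ho : Function.Injective o := fun i j h => by
      simp only [o, Fin.mk.injEq] at h
      omega
    have heo (i j : Fin k) : e i ≠ o j := fun h => by
      simp only [e, o, Fin.mk.injEq] at h
      omega
    have hsub : M.submatrix (Sum.elim e o) (Sum.elim o e) =
        Matrix.fromBlocks (Matrix.of fun i j => (z (o j) - z (e i))⁻¹) 0 0
          (Matrix.of fun i j => (z (e j) - z (o i))⁻¹) := by
      ext (i | i) (j | j) <;>
        simp only [Matrix.submatrix_apply, Sum.elim_inl, Sum.elim_inr, hM,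
          Matrix.fromBlocks_apply₁₁, Matrix.fromBlocks_apply₁₂, Matrix.fromBlocks_apply₂₁,
          Matrix.fromBlocks_apply₂₂, Matrix.of_apply, Matrix.zero_apply, e, o]
      · exact if_pos ⟨i + j, by ring⟩
      · exact if_neg (Nat.not_odd_iff_even.mpr ⟨i + j, by ring⟩)
      · exact if_neg (Nat.not_odd_iff_even.mpr ⟨i + j + 1, by ring⟩)
      · exact if_pos ⟨i + j, by ring⟩
    have hdet : (M.submatrix (Sum.elim e o) (Sum.elim o e)).det ≠ 0 := by
      rw [hsub, Matrix.det_fromBlocks_zero₂₁]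
      exact mul_ne_zero
        (Matrix.det_cauchy_ne_zero (hz.comp he) (hz.comp ho) fun i j => hz.ne (heo i j))
        (Matrix.det_cauchy_ne_zero (hz.comp ho) (hz.comp he) fun i j => hz.ne (heo j i).symm)
    calc 2 * k = (M.submatrix (Sum.elim e o) (Sum.elim o e)).rank := by
          rw [Matrix.rank_of_det_ne_zero hdet, Fintype.card_sum, Fintype.card_fin, two_mul]
      _ ≤ M.rank := M.rank_submatrix_le _ _
end

section
/- Let V be a vector space over ℂ, let d ≥ 0, and let u_0, …, u_d ∈ V be vectors such that for every i ∈ [0,d] the vector u_i lies in the linear span of {u_k : k ≠ i}. Then there exist complex numbers λ_0, …, λ_d, all nonzero, such that Σ_{i=0}^{d} λ_i u_i = 0. -/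
/-- If `u i` is in the span of the other vectors of a finite family over a ring, then some linear
relation of the family has `i`-th coefficient `-1`. -/
lemma exists_sum_smul_eq_zero_of_mem_span_image_ne {R M ι : Type*} [Ring R] [AddCommGroup M]
    [Module R M] [Fintype ι] [DecidableEq ι] {u : ι → M} {i : ι}
    (h : u i ∈ Submodule.span R (u '' {k | k ≠ i})) :
    ∃ c : ι → R, c i = -1 ∧ ∑ k, c k • u k = 0 := by
  obtain ⟨l, hl, hu⟩ := (Finsupp.mem_span_image_iff_linearCombination R).mp h
  have hi : l i = 0 := by
    by_contra hne
    exact hl (Finsupp.mem_support_iff.mpr hne) rfl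
  rw [Finsupp.linearCombination_apply, Finsupp.sum_fintype _ _ (by simp)] at hu
  refine ⟨fun k ↦ l k - Pi.single (M := fun _ ↦ R) i 1 k, by simp [hi], ?_⟩
  simp [sub_smul, Pi.single_apply, hu]

/-- Let `V` be a complex vector space, `d ≥ 0`, and `u 0, …, u d ∈ V` vectors such that each
`u i` lies in the linear span of the other vectors `{u k : k ≠ i}`. Then there exist complex
numbers `λ 0, …, λ d`, all nonzero, with `∑ i, λ i • u i = 0`. -/
theorem exists_nonzero_relation_of_mem_span_others
    (d : ℕ) {V : Type*} [AddCommGroup V] [Module ℂ V]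
    (u : Fin (d + 1) → V)
    (h : ∀ i : Fin (d + 1), u i ∈ Submodule.span ℂ (u '' {k | k ≠ i})) :
    ∃ lam : Fin (d + 1) → ℂ, (∀ i, lam i ≠ 0) ∧ ∑ i : Fin (d + 1), lam i • u i = 0 := by
  let K := LinearMap.ker (Fintype.linearCombination ℂ u)
  let f : Fin (d + 1) → Module.Dual ℂ (Fin (d + 1) → ℂ) := LinearMap.proj
  obtain ⟨lam, hK, hne⟩ := Module.Dual.exists_forall_mem_ne_zero_of_forall_exists K f fun i ↦ by
    obtain ⟨c, hc, hsum⟩ := exists_sum_smul_eq_zero_of_mem_span_image_ne (h i)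
    exact ⟨c, by simpa [K, Fintype.linearCombination_apply] using hsum, by simp [f, hc]⟩
  exact ⟨lam, hne, by simpa [K, Fintype.linearCombination_apply] using hK⟩
end

section
/- Let m be an odd positive integer and let A be an m × m skew-symmetric matrix over ℂ with rank A = m − 1. Then there exists a nonzero vector v ∈ ℂ^m such that the adjugate matrix of A equals v vᵀ; moreover the kernel of A is the one-dimensional subspace spanned by v, and for every i ∈ [1,m] the square of the i-th coordinate of v equals det A(i), where A(i) denotes the skew-symmetric matrix obtained from A by deleting the i-th row and the i-th column. -/
open Matrix

/-- If the kernel of a skew-symmetric matrix is spanned by `u` and `u i ≠ 0`, then the `i`-th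
principal minor does not vanish. -/
theorem Matrix.det_submatrix_succAbove_ne_zero_of_ker_eq_span {K : Type*} [Field K] {n : ℕ}
    {A : Matrix (Fin (n + 1)) (Fin (n + 1)) K} (hskew : Aᵀ = -A) {u : Fin (n + 1) → K}
    (hker : LinearMap.ker A.mulVecLin = Submodule.span K {u}) {i : Fin (n + 1)} (hi : u i ≠ 0) :
    (A.submatrix i.succAbove i.succAbove).det ≠ 0 := by
  intro hdet
  obtain ⟨w, hw, hAw⟩ := Matrix.exists_mulVec_eq_zero_iff.mpr hdet
  have hu : A *ᵥ u = 0 := by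
    have : u ∈ LinearMap.ker A.mulVecLin := hker ▸ Submodule.mem_span_singleton_self u
    simpa using this
  set x : Fin (n + 1) → K := i.insertNth 0 w with hx
  have hxi : x i = 0 := by simp [hx]
  have hxs (j) : x (i.succAbove j) = w j := by simp [hx]
  have hAx (j) : (A *ᵥ x) (i.succAbove j) = 0 := by
    simpa [mulVec, dotProduct, Fin.sum_univ_succAbove _ i, hxi, hxs] using congrFun hAw j
  have hAxi : (A *ᵥ x) i = 0 := by
    have h : u ⬝ᵥ A *ᵥ x = 0 := by
      rw [dotProduct_mulVec, ← mulVec_transpose, hskew, neg_mulVec, hu, neg_zero, zero_dotProduct]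
    simpa [dotProduct, Fin.sum_univ_succAbove _ i, hAx, hi] using h
  have hxker : x ∈ LinearMap.ker A.mulVecLin := by
    rw [LinearMap.mem_ker, mulVecLin_apply]
    funext k
    rcases Fin.eq_self_or_eq_succAbove i k with rfl | ⟨j, rfl⟩
    exacts [hAxi, hAx j]
  rw [hker, Submodule.mem_span_singleton] at hxker
  obtain ⟨c, hc⟩ := hxker
  have hc0 : c = 0 := by
    have := congrFun hc i
    simpa [hxi, hi] using this
  refine hw (funext fun j => ?_)
  rw [← hxs, ← hc, hc0]
  simp

/-- The adjugate of a skew-symmetric matrix of odd size is symmetric. -/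
theorem Matrix.isSymm_adjugate_of_transpose_eq_neg {R : Type*} [CommRing R] {n : ℕ}
    (hodd : Odd (n + 1)) {A : Matrix (Fin (n + 1)) (Fin (n + 1)) R} (hskew : Aᵀ = -A) :
    A.adjugate.IsSymm := by
  have hn : Even n := by grind
  rw [Matrix.IsSymm, adjugate_transpose, hskew, ← neg_one_smul R A, adjugate_smul]
  simp [hn.neg_one_pow]

/-- Let `m = n + 1` be an odd positive integer and let `A` be an `m × m` skew-symmetric
complex matrix of rank `m - 1 = n`. Then there is a nonzero vector `v ∈ ℂ^m` with
`adjugate A = v vᵀ`; moreover the kernel of `A` is the line spanned by `v`, and for every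
`i` the square of the `i`-th coordinate of `v` equals the determinant of the skew-symmetric
matrix `A(i)` obtained from `A` by deleting the `i`-th row and the `i`-th column. -/
theorem adjugate_of_odd_skew_symmetric_corank_one
    (n : ℕ) (hodd : Odd (n + 1))
    (A : Matrix (Fin (n + 1)) (Fin (n + 1)) ℂ)
    (hskew : Aᵀ = -A) (hrank : A.rank = n) :
    ∃ v : Fin (n + 1) → ℂ, v ≠ 0 ∧
      A.adjugate = Matrix.of (fun i j => v i * v j) ∧
      LinearMap.ker A.mulVecLin = Submodule.span ℂ {v} ∧
      ∀ i : Fin (n + 1), (v i) ^ 2 = (A.submatrix i.succAbove i.succAbove).det := by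
  have hfin : Module.finrank ℂ (LinearMap.ker A.mulVecLin) = 1 := by
    have h := A.mulVecLin.finrank_range_add_finrank_ker
    rw [← Matrix.rank, hrank, Module.finrank_fin_fun] at h
    omega
  obtain ⟨u, hu0, hker⟩ : ∃ u : Fin (n + 1) → ℂ, u ≠ 0 ∧
      LinearMap.ker A.mulVecLin = Submodule.span ℂ {u} := by
    obtain ⟨u, hu⟩ := (Submodule.finrank_le_one_iff_isPrincipal _).mp hfin.le
    refine ⟨u, ?_, hu⟩
    rintro rfl
    rw [hu, Submodule.span_zero_singleton, finrank_bot] at hfin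
    exact zero_ne_one hfin
  have hAu : A *ᵥ u = 0 := by
    have : u ∈ LinearMap.ker A.mulVecLin := hker ▸ Submodule.mem_span_singleton_self u
    simpa using this
  have hdet : A.det = 0 := Matrix.exists_mulVec_eq_zero_iff.mp ⟨u, hu0, hAu⟩
  have hcol (j) : ∃ c : ℂ, c • u = A.adjugate.col j := by
    rw [← Submodule.mem_span_singleton, ← hker, LinearMap.mem_ker, mulVecLin_apply]
    funext i
    have h : (A * A.adjugate) i j = 0 := by simp [mul_adjugate, hdet]
    exact h
  choose c hc using hcol
  have hadj (i j) : A.adjugate i j = c j * u i := (congrFun (hc j) i).symm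
  have hsymm := Matrix.isSymm_adjugate_of_transpose_eq_neg hodd hskew
  have hdiag (i) : A.adjugate i i = (A.submatrix i.succAbove i.succAbove).det := by
    simp [adjugate_fin_succ_eq_det_submatrix]
  obtain ⟨k, hk⟩ := Function.ne_iff.mp hu0
  replace hk : u k ≠ 0 := hk
  have hck : c k ≠ 0 := by
    have h := Matrix.det_submatrix_succAbove_ne_zero_of_ker_eq_span hskew hker hk
    rw [← hdiag, hadj] at h
    exact left_ne_zero_of_mul h
  obtain ⟨μ, hμ⟩ := IsAlgClosed.exists_pow_nat_eq (c k / u k) two_pos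
  have hμ0 : μ ≠ 0 := by
    rintro rfl
    exact div_ne_zero hck hk (by simpa using hμ.symm)
  have hadj' (i j) : A.adjugate i j = (μ • u) i * (μ • u) j := by
    have h : c j * u k = c k * u j := by rw [← hadj, ← hadj, hsymm.apply]
    have hcj : c j = μ ^ 2 * u j := by
      rw [hμ]
      field_simp
      exact h
    rw [hadj, hcj]
    simp only [Pi.smul_apply, smul_eq_mul]
    ring
  refine ⟨μ • u, smul_ne_zero hμ0 hu0, by ext i j; exact hadj' i j, ?_, fun i => ?_⟩
  · rw [hker, Submodule.span_singleton_smul_eq hμ0.isUnit]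
  · rw [← hdiag, hadj', sq]
end
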